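/- Periodic Maxwell counts. Let ⟨G,m⟩ be a gain graph and p : V → ℝ² a realization for which the edges of (⟨G,m⟩, p) are independent. Then every subgraph (V',E') with V' nonempty satisfies |E'| ≤ 2|V'| − 2; in particular, if V is nonempty then |E| ≤ 2|V| − 2. -/

import Mathlib

open Finset

namespace PeriodicRigidity

/-- Cast an integer gain vector to a vector of `ℝ × ℝ`. -/
def zcast (z : ℤ × ℤ) : ℝ × ℝ := ((z.1 : ℝ), (z.2 : ℝ))

variable {V E : Type*}

/-- The rigidity row of the edge `e` of the gain graph `(t, h, m)` at the realization `p`: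
its value at a vertex `v` is `d_e` if `v = t e ≠ h e`, `-d_e` if `v = h e ≠ t e`, and `0`
otherwise, where `d_e = p (t e) - p (h e) - m e`. -/
def row [DecidableEq V] (t h : E → V) (m : E → ℤ × ℤ) (p : V → ℝ × ℝ) (e : E) :
    V → ℝ × ℝ := fun v =>
  if t e = h e then 0
  else if v = t e then p (t e) - p (h e) - zcast (m e)
  else if v = h e then -(p (t e) - p (h e) - zcast (m e))
  else 0

/-- The edges of the framework `((t, h, m), p)` are independent. -/
def Indep [DecidableEq V] (t h : E → V) (m : E → ℤ × ℤ) (p : V → ℝ × ℝ) : Prop :=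
  LinearIndependent ℝ (row t h m p)

/-- `(V', E')` is a subgraph of the gain graph with tail map `t` and head map `h`. -/
def IsSubgraph (t h : E → V) (V' : Finset V) (E' : Finset E) : Prop :=
  ∀ e ∈ E', t e ∈ V' ∧ h e ∈ V'

/-- A set of edges is balanced if the gains are given by a potential on the vertices. -/
def Balanced (t h : E → V) (m : E → ℤ × ℤ) (E' : Finset E) : Prop :=
  ∃ φ : V → ℤ × ℤ, ∀ e ∈ E', m e = φ (h e) - φ (t e)

/-- The gain assignment `m` is constructive: no subgraph `(V', E')` with `|V'| ≥ 2` and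
`|E'| = 2 |V'| - 2` is balanced. -/
def Constructive (t h : E → V) (m : E → ℤ × ℤ) : Prop :=
  ∀ (V' : Finset V) (E' : Finset E), IsSubgraph t h V' E' → 2 ≤ V'.card →
    (E'.card : ℤ) = 2 * V'.card - 2 → ¬ Balanced t h m E'

/-- Relative version of `Constructive`, for the graph `(VS, ES)` inside an ambient graph. -/
def ConstructiveOn (t h : E → V) (m : E → ℤ × ℤ) (VS : Finset V) (ES : Finset E) : Prop :=
  ∀ (V' : Finset V) (E' : Finset E), V' ⊆ VS → E' ⊆ ES → IsSubgraph t h V' E' →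
    2 ≤ V'.card → (E'.card : ℤ) = 2 * V'.card - 2 → ¬ Balanced t h m E'

/-- The edge `e` is, up to reversal, an edge from `u` to `v` with gain `g`. -/
def EdgeIs (t h : E → V) (m : E → ℤ × ℤ) (e : E) (u v : V) (g : ℤ × ℤ) : Prop :=
  (t e = u ∧ h e = v ∧ m e = g) ∨ (t e = v ∧ h e = u ∧ m e = -g)

/-- The rigidity row of `e` is `d_e` placed at the tail minus `d_e` placed at the head. -/
lemma row_eq_single_sub_single [DecidableEq V] (t h : E → V) (m : E → ℤ × ℤ) (p : V → ℝ × ℝ)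
    (e : E) :
    row t h m p e = Pi.single (t e) (p (t e) - p (h e) - zcast (m e)) -
      Pi.single (h e) (p (t e) - p (h e) - zcast (m e)) := by
  funext v
  simp only [row, Pi.sub_apply, Pi.single_apply]
  by_cases hth : t e = h e
  · simp [hth]
  · by_cases hvt : v = t e
    · subst hvt
      simp [hth]
    · by_cases hvh : v = h e <;> simp [hth, Ne.symm hth, hvt, hvh]

/-- The functions `V → ℝ × ℝ` that vanish outside `V'` and have total sum zero on `V'`. -/
def balancedLoads (V' : Finset V) : Submodule ℝ (V → ℝ × ℝ) where
  carrier := {f | (∀ v ∉ V', f v = 0) ∧ ∑ v ∈ V', f v = 0}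
  zero_mem' := by simp
  add_mem' := by
    rintro f g ⟨hf, hf'⟩ ⟨hg, hg'⟩
    refine ⟨fun v hv => by simp [hf v hv, hg v hv], ?_⟩
    simp [sum_add_distrib, hf', hg']
  smul_mem' := by
    rintro c f ⟨hf, hf'⟩
    refine ⟨fun v hv => by simp [hf v hv], ?_⟩
    simp [← smul_sum, hf']

lemma row_mem_balancedLoads [DecidableEq V] {t h : E → V} {V' : Finset V} {e : E}
    (m : E → ℤ × ℤ) (p : V → ℝ × ℝ) (ht : t e ∈ V') (hh : h e ∈ V') :
    row t h m p e ∈ balancedLoads V' := by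
  rw [row_eq_single_sub_single]
  refine ⟨fun v hv => ?_, ?_⟩
  · simp [ne_of_mem_of_not_mem ht hv |>.symm,
      ne_of_mem_of_not_mem hh hv |>.symm]
  · simp [sum_sub_distrib, Pi.single_apply, ht, hh]

/-- A load with total sum zero on `V'` is determined by its values off one vertex. -/
lemma disjoint_balancedLoads_ker_restrict [DecidableEq V] {V' : Finset V} {v₀ : V}
    (hv₀ : v₀ ∈ V') :
    Disjoint (balancedLoads V')
      (LinearMap.ker (LinearMap.funLeft ℝ (ℝ × ℝ) ((↑) : V'.erase v₀ → V))) := by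
  rw [Submodule.disjoint_def]
  rintro f ⟨hf, hsum⟩ hker
  have hoff : ∀ v ∈ V'.erase v₀, f v = 0 := fun v hv => congrFun hker ⟨v, hv⟩
  rw [← add_sum_erase _ _ hv₀, sum_eq_zero hoff, add_zero] at hsum
  funext v
  by_cases hv : v = v₀
  · rw [hv, hsum, Pi.zero_apply]
  · by_cases hvV : v ∈ V'
    · exact hoff v (mem_erase.2 ⟨hv, hvV⟩)
    · exact hf v hvV

lemma Indep.card_le [DecidableEq V] {t h : E → V} {m : E → ℤ × ℤ} {p : V → ℝ × ℝ}
    (hp : Indep t h m p) {V' : Finset V} {E' : Finset E} (hsub : IsSubgraph t h V' E')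
    (hV' : V'.Nonempty) : (E'.card : ℤ) ≤ 2 * V'.card - 2 := by
  obtain ⟨v₀, hv₀⟩ := hV'
  have hrows : LinearIndependent ℝ (fun e : E' => row t h m p e) :=
    LinearIndependent.comp hp _ Subtype.val_injective
  have hspan : Submodule.span ℝ (Set.range fun e : E' => row t h m p e) ≤ balancedLoads V' := by
    rw [Submodule.span_le]
    rintro _ ⟨e, rfl⟩
    exact row_mem_balancedLoads m p (hsub e e.2).1 (hsub e e.2).2
  have hcard := (hrows.map
    ((disjoint_balancedLoads_ker_restrict hv₀).mono_left hspan)).fintype_card_le_finrank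
  rw [Module.finrank_pi_fintype] at hcard
  simp only [Module.finrank_prod, Module.finrank_self, sum_const, card_univ,
    Fintype.card_coe, smul_eq_mul] at hcard
  have := card_erase_add_one hv₀
  lia

/-- **Periodic Maxwell counts.** If the edges of `(⟨G, m⟩, p)` are independent, then every
subgraph `(V', E')` with `V'` nonempty satisfies `|E'| ≤ 2 |V'| - 2`; in particular, if `V`
is nonempty then `|E| ≤ 2 |V| - 2`. -/
theorem periodic_maxwell {V E : Type*} [Fintype V] [Fintype E] [DecidableEq V]
    (t h : E → V) (m : E → ℤ × ℤ) (p : V → ℝ × ℝ)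
    (hp : Indep t h m p) :
    (∀ (V' : Finset V) (E' : Finset E), IsSubgraph t h V' E' → V'.Nonempty →
        (E'.card : ℤ) ≤ 2 * V'.card - 2) ∧
    (Nonempty V → (Fintype.card E : ℤ) ≤ 2 * Fintype.card V - 2) := by
  refine ⟨fun V' E' hsub hV' => hp.card_le hsub hV', fun _ => ?_⟩
  have hsub : IsSubgraph t h univ univ := fun e _ => ⟨mem_univ _, mem_univ _⟩
  simpa only [card_univ] using hp.card_le hsub univ_nonempty

end PeriodicRigidity
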